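/- Let a, b > 0 and let ℓ be the critical length of the operator D⁴ + 2(b²−a²)D² + (a²+b²)², whose four-dimensional kernel is spanned by cosh(ax)cos(bx), sinh(ax)cos(bx), cosh(ax)sin(bx), sinh(ax)sin(bx). Then ℓ lies in (π/b, 3π/(2b)) and is the unique x in that interval satisfying b·tanh(ax) = a·tan(bx). Moreover, letting S₃ be the kernel element with S₃(0) = S₃'(0) = S₃''(0) = 0 and S₃'''(0) = 1, ℓ is the first positive zero of S₃, while the Wronskian W(S₃, S₃')(x) = S₃(x)S₃''(x) − S₃'(x)² has no zero in (0, +∞). -/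

import Mathlib

open scoped BigOperators

noncomputable section

/-- `F` vanishes to order at least `m` at `x`: all derivatives of order `< m` vanish at `x`. -/
def VanishAtLeast (F : ℝ → ℝ) (m : ℕ) (x : ℝ) : Prop :=
  ∀ j < m, iteratedDeriv j F x = 0

/-- `F` vanishes at most `N` times in `J`, counting multiplicities up to `μ`. -/
def VanishAtMost (F : ℝ → ℝ) (μ N : ℕ) (J : Set ℝ) : Prop :=
  ∀ (r : ℕ) (xs : Fin r → ℝ) (m : Fin r → ℕ),
    (∀ i, xs i ∈ J) → Function.Injective xs →
    (∀ i, 1 ≤ m i) → (∀ i, m i ≤ μ) →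
    (∀ i, VanishAtLeast F (m i) (xs i)) →
    ∑ i, m i ≤ N

/-- Kernel of the operator `L = D^(n+1) + ∑_{i=0}^n a i • D^i`. -/
def kerOp (n : ℕ) (a : Fin (n + 1) → ℝ) : Set (ℝ → ℝ) :=
  {F | ContDiff ℝ (⊤ : ℕ∞) F ∧
    ∀ x : ℝ, iteratedDeriv (n + 1) F x + ∑ i : Fin (n + 1), a i * iteratedDeriv (i : ℕ) F x = 0}

/-- The (restriction of the) kernel of `L` is an Extended Chebyshev space on `J`. -/
def IsECOn (n : ℕ) (a : Fin (n + 1) → ℝ) (J : Set ℝ) : Prop :=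
  ∀ F ∈ kerOp n a, F ≠ 0 → VanishAtMost F (n + 1) n J

/-- Critical length of the operator `L = D^(n+1) + ∑ a i • D^i`, as an extended real. -/
def critLen (n : ℕ) (a : Fin (n + 1) → ℝ) : EReal :=
  sSup {l : EReal | ∃ h : ℝ, l = (h : EReal) ∧ 0 < h ∧ IsECOn n a (Set.Icc 0 h)}


/-- First order Wronskian. -/
def Wr (u F : ℝ → ℝ) : ℝ → ℝ := fun x => u x * deriv F x - deriv u x * F x

/-- `f` has `n` zeros (with multiplicities) in `[0,h]`, listed in increasing order. -/
def HZ (n : ℕ) (h : ℝ) (f : ℝ → ℝ) : Prop :=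
  ∃ t : ℕ → ℝ, (∀ i j, i ≤ j → j < n → t i ≤ t j) ∧ (∀ i < n, t i ∈ Set.Icc 0 h) ∧
    ∀ i k, i + k < n → t i = t (i + k) → iteratedDeriv k f (t i) = 0

abbrev Smooth (f : ℝ → ℝ) : Prop := ContDiff ℝ (⊤ : ℕ∞) f

lemma Smooth.deriv' {f : ℝ → ℝ} (hf : Smooth f) : Smooth (deriv f) := by
  have := hf.iterate_deriv 1
  simpa using this

lemma Smooth.diff {f : ℝ → ℝ} (hf : Smooth f) : Differentiable ℝ f :=
  hf.differentiable (by simp)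

lemma Smooth.hd {f : ℝ → ℝ} (hf : Smooth f) (x : ℝ) : HasDerivAt f (deriv f x) x :=
  (hf.diff x).hasDerivAt

lemma smooth_Wr {u F : ℝ → ℝ} (hu : Smooth u) (hF : Smooth F) : Smooth (Wr u F) :=
  (hu.mul hF.deriv').sub (hu.deriv'.mul hF)

lemma Smooth.at {f : ℝ → ℝ} (hf : Smooth f) (n : ℕ) (x : ℝ) : ContDiffAt ℝ n f x :=
  (hf.of_le (by exact_mod_cast le_top)).contDiffAt

lemma leib {g F : ℝ → ℝ} (hg : Smooth g) (hF : Smooth F) (m : ℕ) (x : ℝ)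
    (hv : VanishAtLeast F m x) :
    iteratedDeriv m (g * F) x = g x * iteratedDeriv m F x := by
  rw [iteratedDeriv_mul (hg.at m x) (hF.at m x)]
  rw [Finset.sum_eq_single 0]
  · simp
  · intro i hi hi0
    rw [hv (m - i) (by simp at hi; omega)]; simp
  · simp

lemma vanish_deriv {F : ℝ → ℝ} {m : ℕ} {x : ℝ} (hv : VanishAtLeast F (m + 1) x) :
    VanishAtLeast (deriv F) m x := by
  intro j hj
  have := hv (j + 1) (by omega)
  rwa [iteratedDeriv_succ'] at this

lemma Wr_top {u F : ℝ → ℝ} (hu : Smooth u) (hF : Smooth F) (m : ℕ) (x : ℝ)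
    (hv : VanishAtLeast F (m + 1) x) :
    iteratedDeriv m (Wr u F) x = u x * iteratedDeriv (m + 1) F x := by
  have e : Wr u F = u * deriv F - deriv u * F := rfl
  rw [e, iteratedDeriv_sub (Smooth.at (f := u * deriv F) (hu.mul hF.deriv') m x)
      (Smooth.at (f := deriv u * F) (hu.deriv'.mul hF) m x),
    leib hu hF.deriv' m x (vanish_deriv hv),
    leib hu.deriv' hF m x (fun j hj => hv j (by omega)), hv m (by omega), iteratedDeriv_succ']
  ring

lemma Wr_vanish {u F : ℝ → ℝ} (hu : Smooth u) (hF : Smooth F) (m : ℕ) (x : ℝ)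
    (hv : VanishAtLeast F (m + 1) x) : VanishAtLeast (Wr u F) m x := by
  intro j hj
  rw [Wr_top hu hF j x (fun i hi => hv i (by omega)), hv (j + 1) (by omega), mul_zero]

lemma vanish_of_Wr {u F : ℝ → ℝ} (hu : Smooth u) (hF : Smooth F) (m : ℕ) (x : ℝ)
    (hux : u x ≠ 0) (h0 : F x = 0)
    (hv : VanishAtLeast (Wr u F) m x) : VanishAtLeast F (m + 1) x := by
  induction m with
  | zero => intro j hj; obtain rfl : j = 0 := by omega
            simpa using h0
  | succ m ih =>
    have h1 := ih (fun j hj => hv j (by omega))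
    have h2 := Wr_top hu hF m x h1
    rw [hv m (by omega)] at h2
    have h3 : iteratedDeriv (m + 1) F x = 0 := by
      rcases mul_eq_zero.1 h2.symm with h | h
      · exact absurd h hux
      · exact h
    intro j hj
    rcases Nat.lt_succ_iff_lt_or_eq.1 hj with h | h
    · exact h1 j h
    · rw [h]; exact h3

lemma rolle_step {u F : ℝ → ℝ} {h : ℝ} (hu : Smooth u) (hF : Smooth F)
    (hu0 : ∀ x ∈ Set.Icc 0 h, u x ≠ 0) (n : ℕ) (hz : HZ (n + 1) h F) : HZ n h (Wr u F) := by
  obtain ⟨t, hmono, hmem, hzero⟩ := hz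
  have key : ∀ i, ∃ s, i < n → (t i ≤ s ∧ s ≤ t (i + 1)) ∧
      (t i < t (i + 1) → t i < s ∧ s < t (i + 1) ∧ Wr u F s = 0) := by
    intro i
    by_cases hi : i < n
    · rcases (hmono i (i + 1) (by omega) (by omega)).lt_or_eq with hlt | heq
      · have hsub : Set.Icc (t i) (t (i + 1)) ⊆ Set.Icc 0 h := fun y hy =>
          ⟨(hmem i (by omega)).1.trans hy.1, hy.2.trans (hmem (i + 1) (by omega)).2⟩
        have hder : ∀ x ∈ Set.Icc (t i) (t (i + 1)), HasDerivAt (fun y => F y / u y)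
            ((deriv F x * u x - F x * deriv u x) / u x ^ 2) x := fun x hx =>
          (hF.hd x).div (hu.hd x) (hu0 x (hsub hx))
        have z1 : F (t i) = 0 := by simpa using hzero i 0 (by omega) rfl
        have z2 : F (t (i + 1)) = 0 := by simpa using hzero (i + 1) 0 (by omega) rfl
        obtain ⟨c, hc, hc0⟩ := exists_hasDerivAt_eq_zero hlt
          (fun x hx => (hder x hx).continuousAt.continuousWithinAt)
          (by simp [z1, z2]) (fun x hx => hder x (Set.Ioo_subset_Icc_self hx))
        refine ⟨c, fun _ => ⟨⟨hc.1.le, hc.2.le⟩, fun _ => ⟨hc.1, hc.2, ?_⟩⟩⟩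
        have hne := hu0 c (hsub (Set.Ioo_subset_Icc_self hc))
        rcases div_eq_zero_iff.1 hc0 with h1 | h1
        · unfold Wr; linarith
        · exact absurd h1 (pow_ne_zero _ hne)
      · exact ⟨t i, fun _ => ⟨⟨le_rfl, heq.le⟩, fun hl => absurd heq hl.ne⟩⟩
    · exact ⟨0, fun hh => absurd hh hi⟩
  choose s hs using key
  have tsub : ∀ i j, i ≤ j → j < n → s i ≤ s j := by
    intro i j hij hj
    rcases hij.lt_or_eq with hlt | rfl
    · exact ((hs i (by omega)).1.2.trans (hmono (i + 1) j (by omega) (by omega))).trans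
        (hs j hj).1.1
    · exact le_rfl
  refine ⟨s, tsub, fun i hi => ⟨(hmem i (by omega)).1.trans (hs i hi).1.1,
    (hs i hi).1.2.trans (hmem (i + 1) (by omega)).2⟩, ?_⟩
  intro i k hik heq
  by_cases hall : t i = t (i + k + 1)
  · have hti : t i = s i := by
      apply le_antisymm (hs i (by omega)).1.1
      calc s i ≤ t (i + 1) := (hs i (by omega)).1.2
        _ ≤ t (i + k + 1) := hmono _ _ (by omega) (by omega)
        _ = t i := hall.symm
    rw [← hti]
    have hv : VanishAtLeast F (k + 2) (t i) := by
      intro j hj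
      apply hzero i j (by omega)
      apply le_antisymm (hmono _ _ (by omega) (by omega))
      rw [hall]; exact hmono _ _ (by omega) (by omega)
    exact Wr_vanish hu hF (k + 1) (t i) hv k (by omega)
  · rcases Nat.eq_zero_or_pos k with rfl | hk
    · have hlt : t i < t (i + 1) := lt_of_le_of_ne (hmono _ _ (by omega) (by omega)) hall
      simpa using ((hs i (by omega)).2 hlt).2.2
    · exfalso
      have e1 : s i ≤ t (i + 1) := (hs i (by omega)).1.2
      have e2 : t (i + 1) ≤ t (i + k) := hmono _ _ (by omega) (by omega)
      have e3 : t (i + k) ≤ s (i + k) := (hs (i + k) hik).1.1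
      have f1 : t i = t (i + 1) := by
        by_contra hne
        have hlt : t i < t (i + 1) := lt_of_le_of_ne (hmono _ _ (by omega) (by omega)) hne
        have := ((hs i (by omega)).2 hlt).2.1
        linarith
      have f2 : t (i + k) = t (i + k + 1) := by
        by_contra hne
        have hlt : t (i + k) < t (i + k + 1) :=
          lt_of_le_of_ne (hmono _ _ (by omega) (by omega)) hne
        have := ((hs (i + k) hik).2 hlt).1
        linarith
      apply hall; rw [f1, ← f2]; linarith

lemma HZ_exists {n : ℕ} {h : ℝ} {f : ℝ → ℝ} (hz : HZ (n + 1) h f) :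
    ∃ x ∈ Set.Icc 0 h, f x = 0 := by
  obtain ⟨t, -, h2, h3⟩ := hz
  exact ⟨t 0, h2 0 (by omega), by simpa using h3 0 0 (by omega) rfl⟩

lemma HZ_of_zeros {F : ℝ → ℝ} {h : ℝ} {N r : ℕ} (xs : Fin r → ℝ) (m : Fin r → ℕ)
    (hJ : ∀ i, xs i ∈ Set.Icc 0 h) (hinj : Function.Injective xs)
    (hv : ∀ i, VanishAtLeast F (m i) (xs i)) (hN : N ≤ ∑ i, m i) : HZ N h F := by
  classical
  set M : Multiset ℝ := ∑ i, Multiset.replicate (m i) (xs i) with hM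
  have hcard : M.card = ∑ i, m i := by simp [hM]
  have hcount : ∀ j, M.count (xs j) = m j := by
    intro j
    rw [hM, Multiset.count_sum', Finset.sum_eq_single j]
    · simp
    · intro i _ hij
      rw [Multiset.count_replicate, if_neg]
      intro h'; exact hij (hinj h')
    · simp
  have hmem : ∀ x ∈ M, ∃ j, x = xs j := by
    intro x hx
    rw [hM, Multiset.mem_sum] at hx
    obtain ⟨j, -, hj⟩ := hx
    exact ⟨j, Multiset.eq_of_mem_replicate hj⟩
  set l := M.sort (· ≤ ·) with hl
  have hlen : l.length = ∑ i, m i := by rw [hl, Multiset.length_sort, hcard]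
  have hsort : l.SortedLE := (Multiset.pairwise_sort M (· ≤ ·)).sortedLE
  have hml : ∀ x ∈ l, ∃ j, x = xs j := fun x hx => hmem x ((Multiset.mem_sort (· ≤ ·)).1 hx)
  have hcl : ∀ j, l.count (xs j) = m j := by
    intro j
    rw [← hcount j, ← Multiset.coe_count, hl, Multiset.sort_eq]
  have hget : ∀ i (hi : i < l.length), l.getD i 0 = l[i] := fun i hi => by simp [hi]
  refine ⟨fun i => l.getD i 0, ?_, ?_, ?_⟩
  · intro i j hij hj
    simp only []
    rw [hget i (by omega), hget j (by omega)]
    exact hsort.getElem_le_getElem_of_le hij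
  · intro i hi
    simp only []
    rw [hget i (by omega)]
    obtain ⟨j, hj⟩ := hml _ (List.getElem_mem (by omega : i < l.length))
    rw [hj]; exact hJ j
  · intro i k hik heq
    simp only [] at heq ⊢
    rw [hget i (by omega), hget (i + k) (by omega)] at heq
    rw [hget i (by omega)]
    obtain ⟨j, hj⟩ := hml _ (List.getElem_mem (by omega : i < l.length))
    rw [hj]
    apply hv j
    rw [← hcl j, Nat.lt_iff_add_one_le, ← List.replicate_sublist_iff]
    have hrep : (l.drop i).take (k + 1) = List.replicate (k + 1) (xs j) := by
      rw [List.eq_replicate_iff]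
      refine ⟨by simp; omega, ?_⟩
      intro y hy
      obtain ⟨q, hq, rfl⟩ := List.mem_iff_getElem.1 hy
      simp only [List.length_take, List.length_drop] at hq
      simp only [List.getElem_take, List.getElem_drop]
      rw [← hj]
      apply le_antisymm
      · rw [heq]; exact hsort.getElem_le_getElem_of_le (by omega)
      · exact hsort.getElem_le_getElem_of_le (by omega)
    rw [← hrep]
    exact (List.take_sublist _ _).trans (List.drop_sublist _ _)

/-- Chain of derivatives of a solution of the fourth order equation. -/
def Ch (p q : ℝ) (F F1 F2 F3 : ℝ → ℝ) : Prop :=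
  (∀ x, HasDerivAt F (F1 x) x) ∧ (∀ x, HasDerivAt F1 (F2 x) x) ∧ (∀ x, HasDerivAt F2 (F3 x) x) ∧
    ∀ x, HasDerivAt F3 (-(p * F x + q * F2 x)) x

lemma Ch.smul_sub {p q c : ℝ} {F F1 F2 F3 G G1 G2 G3 : ℝ → ℝ} (hF : Ch p q F F1 F2 F3)
    (hG : Ch p q G G1 G2 G3) :
    Ch p q (fun x => F x - c * G x) (fun x => F1 x - c * G1 x) (fun x => F2 x - c * G2 x)
      (fun x => F3 x - c * G3 x) := by
  obtain ⟨a1, a2, a3, a4⟩ := hF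
  obtain ⟨b1, b2, b3, b4⟩ := hG
  refine ⟨fun x => (a1 x).sub ((b1 x).const_mul c), fun x => (a2 x).sub ((b2 x).const_mul c),
    fun x => (a3 x).sub ((b3 x).const_mul c), fun x => ?_⟩
  refine HasDerivAt.congr_deriv ((a4 x).sub ((b4 x).const_mul c)) ?_
  ring

lemma Ch.deriv' {p q : ℝ} {F F1 F2 F3 : ℝ → ℝ} (hF : Ch p q F F1 F2 F3) :
    Ch p q F1 F2 F3 (fun x => -(p * F x + q * F2 x)) := by
  obtain ⟨a1, a2, a3, a4⟩ := hF
  exact ⟨a2, a3, a4, fun x => (((a1 x).const_mul p).add ((a3 x).const_mul q)).neg⟩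

lemma Ch.uniq {p q : ℝ} {F F1 F2 F3 : ℝ → ℝ} (hF : Ch p q F F1 F2 F3) (x₀ : ℝ)
    (h0 : F x₀ = 0) (h1 : F1 x₀ = 0) (h2 : F2 x₀ = 0) (h3 : F3 x₀ = 0) : ∀ x, F x = 0 := by
  obtain ⟨a1, a2, a3, a4⟩ := hF
  let f : ℝ → Fin 4 → ℝ := fun x => ![F x, F1 x, F2 x, F3 x]
  let A : Matrix (Fin 4) (Fin 4) ℝ := !![0, 1, 0, 0; 0, 0, 1, 0; 0, 0, 0, 1; -p, 0, -q, 0]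
  let L : (Fin 4 → ℝ) →L[ℝ] (Fin 4 → ℝ) := LinearMap.toContinuousLinearMap (Matrix.toLin' A)
  have hL : ∀ v, L v = A.mulVec v := fun v => by simp [L]
  have hf : ∀ x, HasDerivAt f (L (f x)) x := by
    intro x
    rw [hasDerivAt_pi, hL]
    intro i
    fin_cases i
    · simpa [f, A, Matrix.mulVec, dotProduct, Fin.sum_univ_four] using a1 x
    · simpa [f, A, Matrix.mulVec, dotProduct, Fin.sum_univ_four] using a2 x
    · simpa [f, A, Matrix.mulVec, dotProduct, Fin.sum_univ_four] using a3 x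
    · refine HasDerivAt.congr_deriv (a4 x) ?_
      simp [f, A, Matrix.mulVec, dotProduct, Fin.sum_univ_four]; ring
  have := ODE_solution_unique_univ (v := fun _ => L) (s := fun _ => Set.univ) (K := ‖L‖₊)
    (f := f) (g := fun _ => 0) (t₀ := x₀) (fun t => L.lipschitz.lipschitzOnWith)
    (fun t => ⟨hf t, trivial⟩)
    (fun t => ⟨by simpa using hasDerivAt_const t (0 : Fin 4 → ℝ), trivial⟩)
    (by ext i; fin_cases i <;> simp [f, h0, h1, h2, h3])
  intro x
  have := congrFun (congrFun this x) 0
  simpa [f] using this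

/-- The abstract Pólya-type argument. -/
lemma no_four_zeros {p q h : ℝ} {u1 u2 u3 u4 F F1 F2 F3 : ℝ → ℝ} (hu : Ch p q u1 u2 u3 u4)
    (hF : Ch p q F F1 F2 F3) (s1 : Smooth u1) (s2 : Smooth u2) (s3 : Smooth u3)
    (sF : Smooth F)
    (w1 : ∀ x ∈ Set.Icc 0 h, u1 x ≠ 0)
    (w2 : ∀ x ∈ Set.Icc 0 h, u1 x * u3 x - u2 x ^ 2 ≠ 0)
    (w3 : ∀ x ∈ Set.Icc 0 h, (u1 x * u3 x - u2 x ^ 2) *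
      (u1 x * (-(p * u1 x + q * u3 x)) - u3 x ^ 2) - (u1 x * u4 x - u2 x * u3 x) ^ 2 ≠ 0)
    (hz : HZ 4 h F) : ∀ x, F x = 0 := by
  have d1 : deriv u1 = u2 := funext fun x => (hu.1 x).deriv
  have d2 : deriv u2 = u3 := funext fun x => (hu.2.1 x).deriv
  have d3 : deriv u3 = u4 := funext fun x => (hu.2.2.1 x).deriv
  have dF : deriv F = F1 := funext fun x => (hF.1 x).deriv
  have dF1 : deriv F1 = F2 := funext fun x => (hF.2.1 x).deriv
  have dF2 : deriv F2 = F3 := funext fun x => (hF.2.2.1 x).deriv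
  set A2 := Wr u1 u2 with hA2
  set B := Wr u1 u3 with hB
  set A3 := Wr A2 B with hA3
  have sA2 : Smooth A2 := smooth_Wr s1 s2
  have sB : Smooth B := smooth_Wr s1 s3
  have sA3 : Smooth A3 := smooth_Wr sA2 sB
  have eA2 : ∀ x, A2 x = u1 x * u3 x - u2 x ^ 2 := fun x => by
    simp only [hA2, Wr, d1, d2]; ring
  have eB : ∀ x, B x = u1 x * u4 x - u2 x * u3 x := fun x => by
    simp only [hB, Wr, d1, d3]
  have dA2 : deriv A2 = B := funext fun x => by
    have : HasDerivAt A2 (B x) x := by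
      rw [show A2 = fun x => u1 x * u3 x - u2 x * u2 x from funext fun y => by rw [eA2]; ring]
      refine HasDerivAt.congr_deriv (((hu.1 x).mul (hu.2.2.1 x)).sub ((hu.2.1 x).mul (hu.2.1 x))) ?_
      rw [eB]; ring
    exact this.deriv
  have dB : ∀ x, deriv B x = u1 x * (-(p * u1 x + q * u3 x)) - u3 x ^ 2 := fun x => by
    have : HasDerivAt B (u1 x * (-(p * u1 x + q * u3 x)) - u3 x ^ 2) x := by
      rw [show B = fun x => u1 x * u4 x - u2 x * u3 x from funext fun y => by rw [eB]]
      refine HasDerivAt.congr_deriv (((hu.1 x).mul (hu.2.2.2 x)).sub ((hu.2.1 x).mul (hu.2.2.1 x))) ?_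
      ring
    exact this.deriv
  have n2 : ∀ x ∈ Set.Icc 0 h, A2 x ≠ 0 := fun x hx => by rw [eA2]; exact w2 x hx
  have n3 : ∀ x ∈ Set.Icc 0 h, A3 x ≠ 0 := fun x hx => by
    have : A3 x = A2 x * deriv B x - deriv A2 x * B x := rfl
    rw [this, dA2, dB, eA2, eB, ← sq]; exact w3 x hx
  set T1 := Wr u1 F with hT1
  set T2 := Wr A2 T1 with hT2
  set T3 := Wr A3 T2 with hT3
  have sT1 : Smooth T1 := smooth_Wr s1 sF
  have sT2 : Smooth T2 := smooth_Wr sA2 sT1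
  have z1 : HZ 3 h T1 := rolle_step s1 sF w1 3 hz
  have z2 : HZ 2 h T2 := rolle_step sA2 sT1 n2 2 z1
  have z3 : HZ 1 h T3 := rolle_step sA3 sT2 n3 1 z2
  obtain ⟨s, hs, hs0⟩ := HZ_exists z3
  obtain ⟨y2, hy2, hy20⟩ := HZ_exists z2
  obtain ⟨y1, hy1, hy10⟩ := HZ_exists z1
  obtain ⟨y0, hy0, hy00⟩ := HZ_exists hz
  obtain ⟨γ, hγ⟩ : ∃ γ, T2 s - γ * A3 s = 0 := ⟨T2 s / A3 s, by field_simp [n3 s hs]; ring⟩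
  obtain ⟨β, hβ⟩ : ∃ β, T1 s - γ * B s - β * A2 s = 0 :=
    ⟨(T1 s - γ * B s) / A2 s, by rw [div_mul_cancel₀ _ (n2 s hs)]; ring⟩
  obtain ⟨α, hα⟩ : ∃ α, F s - γ * u3 s - β * u2 s - α * u1 s = 0 :=
    ⟨(F s - γ * u3 s - β * u2 s) / u1 s, by rw [div_mul_cancel₀ _ (w1 s hs)]; ring⟩
  set G : ℝ → ℝ := fun x => F x - γ * u3 x - β * u2 x - α * u1 x with hG
  have cG := ((hF.smul_sub (c := γ) hu.deriv'.deriv').smul_sub (c := β) hu.deriv').smul_sub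
    (c := α) hu
  have sG : Smooth G := ((sF.sub (contDiff_const.mul s3)).sub (contDiff_const.mul s2)).sub
    (contDiff_const.mul s1)
  have g1 : Wr u1 G = fun x => T1 x - γ * B x - β * A2 x := funext fun x => by
    have : deriv G x = _ := (cG.1 x).deriv
    simp only [Wr, hT1, hB, hA2, this, d1, d2, d3, dF]; simp only [hG]; ring
  have g2 : Wr A2 (Wr u1 G) = fun x => T2 x - γ * A3 x := funext fun x => by
    have : HasDerivAt (Wr u1 G) (deriv T1 x - γ * deriv B x - β * deriv A2 x) x := by
      rw [g1]
      exact ((sT1.hd x).sub ((sB.hd x).const_mul γ)).sub ((sA2.hd x).const_mul β)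
    have e : Wr A2 (Wr u1 G) x = A2 x * deriv (Wr u1 G) x - deriv A2 x * Wr u1 G x := rfl
    rw [e, this.deriv, g1, hT2, hA3]
    simp only [Wr]; ring
  have g3 : Wr A3 (Wr A2 (Wr u1 G)) = T3 := funext fun x => by
    have : HasDerivAt (Wr A2 (Wr u1 G)) (deriv T2 x - γ * deriv A3 x) x := by
      rw [g2]
      exact (sT2.hd x).sub ((sA3.hd x).const_mul γ)
    have e : Wr A3 (Wr A2 (Wr u1 G)) x =
      A3 x * deriv (Wr A2 (Wr u1 G)) x - deriv A3 x * (Wr A2 (Wr u1 G)) x := rfl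
    rw [e, this.deriv, g2, hT3]
    simp only [Wr]; ring
  have sW1 := smooth_Wr s1 sG
  have sW2 := smooth_Wr sA2 sW1
  have v3 : VanishAtLeast (Wr A3 (Wr A2 (Wr u1 G))) 1 s := by
    intro j hj; obtain rfl : j = 0 := by omega
    rw [g3]; simpa using hs0
  have v2 := vanish_of_Wr sA3 sW2 1 s (n3 s hs) (by rw [g2]; exact hγ) v3
  have v1 := vanish_of_Wr sA2 sW1 2 s (n2 s hs) (by rw [g1]; exact hβ) v2
  have v0 := vanish_of_Wr s1 sG 3 s (w1 s hs) hα v1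
  have G0 : ∀ x, G x = 0 := by
    have dG : deriv G = _ := funext fun x => (cG.1 x).deriv
    have dG1 := funext fun x => (cG.2.1 x).deriv
    have dG2 := funext fun x => (cG.2.2.1 x).deriv
    have q1 := v0 1 (by omega)
    have q2 := v0 2 (by omega)
    have q3 := v0 3 (by omega)
    rw [iteratedDeriv_succ', dG] at q1 q2 q3
    rw [iteratedDeriv_succ', dG1] at q2 q3
    rw [iteratedDeriv_succ', dG2] at q3
    rw [iteratedDeriv_zero] at q1 q2 q3
    exact cG.uniq s hα q1 q2 q3
  have W0 : ∀ x, Wr u1 G x = 0 := fun x => by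
    have : deriv G x = 0 := by rw [show G = fun _ => 0 from funext G0]; simp
    simp [Wr, this, G0]
  have γ0 : γ = 0 := by
    have : Wr A2 (Wr u1 G) y2 = 0 := by
      rw [show Wr u1 G = fun _ => 0 from funext W0]; simp [Wr]
    rw [g2] at this
    simp only [hy20] at this
    have h' : γ * A3 y2 = 0 := by linarith
    exact (mul_eq_zero.1 h').resolve_right (n3 y2 hy2)
  have β0 : β = 0 := by
    have := W0 y1
    rw [g1] at this
    simp only [hy10, γ0] at this
    have h' : β * A2 y1 = 0 := by linarith
    exact (mul_eq_zero.1 h').resolve_right (n2 y1 hy1)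
  have α0 : α = 0 := by
    have := G0 y0
    simp only [hG, hy00, γ0, β0] at this
    have h' : α * u1 y0 = 0 := by linarith
    exact (mul_eq_zero.1 h').resolve_right (w1 y0 hy0)
  intro x
  have := G0 x
  simp only [hG, γ0, β0, α0] at this
  linarith

open Real in
/-- The unnormalised function `S₃`, and its derivatives. -/
def q0 (a b x : ℝ) : ℝ := b * (sinh (a * x) * cos (b * x)) - a * (cosh (a * x) * sin (b * x))

open Real in
def q1 (a b x : ℝ) : ℝ := -(a ^ 2 + b ^ 2) * (sinh (a * x) * sin (b * x))

open Real in
def q2 (a b x : ℝ) : ℝ :=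
  -(a ^ 2 + b ^ 2) * (a * (cosh (a * x) * sin (b * x)) + b * (sinh (a * x) * cos (b * x)))

open Real in
def q3 (a b x : ℝ) : ℝ :=
  -(a ^ 2 + b ^ 2) *
    ((a ^ 2 - b ^ 2) * (sinh (a * x) * sin (b * x)) + 2 * a * b * (cosh (a * x) * cos (b * x)))

section
open Real

lemma hd_sh (a x : ℝ) : HasDerivAt (fun x => sinh (a * x)) (cosh (a * x) * a) x := by
  simpa using ((hasDerivAt_id x).const_mul a).sinh

lemma hd_ch (a x : ℝ) : HasDerivAt (fun x => cosh (a * x)) (sinh (a * x) * a) x := by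
  simpa using ((hasDerivAt_id x).const_mul a).cosh

lemma hd_si (a x : ℝ) : HasDerivAt (fun x => sin (a * x)) (cos (a * x) * a) x := by
  simpa using ((hasDerivAt_id x).const_mul a).sin

lemma hd_co (a x : ℝ) : HasDerivAt (fun x => cos (a * x)) (-sin (a * x) * a) x := by
  simpa using ((hasDerivAt_id x).const_mul a).cos

lemma q_chain (a b : ℝ) :
    Ch ((a ^ 2 + b ^ 2) ^ 2) (2 * (b ^ 2 - a ^ 2)) (q0 a b) (q1 a b) (q2 a b) (q3 a b) := by
  refine ⟨fun x => ?_, fun x => ?_, fun x => ?_, fun x => ?_⟩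
  · refine HasDerivAt.congr_deriv ((((hd_sh a x).mul (hd_co b x)).const_mul b).sub
      (((hd_ch a x).mul (hd_si b x)).const_mul a)) ?_
    unfold q1; ring
  · refine HasDerivAt.congr_deriv (((hd_sh a x).mul (hd_si b x)).const_mul _) ?_
    unfold q2; ring
  · refine HasDerivAt.congr_deriv (((((hd_ch a x).mul (hd_si b x)).const_mul a).add
      (((hd_sh a x).mul (hd_co b x)).const_mul b)).const_mul _) ?_
    unfold q3; ring
  · refine HasDerivAt.congr_deriv (((((hd_sh a x).mul (hd_si b x)).const_mul _).add
      (((hd_ch a x).mul (hd_co b x)).const_mul _)).const_mul _) ?_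
    unfold q0 q2; ring

lemma q0_smooth (a b : ℝ) : Smooth (q0 a b) := by unfold q0; unfold Smooth; fun_prop
lemma q1_smooth (a b : ℝ) : Smooth (q1 a b) := by unfold q1; unfold Smooth; fun_prop
lemma q2_smooth (a b : ℝ) : Smooth (q2 a b) := by unfold q2; unfold Smooth; fun_prop

lemma q_wr (a b x : ℝ) : q0 a b x * q2 a b x - q1 a b x ^ 2 =
    -(a ^ 2 + b ^ 2) * (b ^ 2 * sinh (a * x) ^ 2 - a ^ 2 * sin (b * x) ^ 2) := by
  have h1 := cosh_sq (a * x)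
  have h2 := cos_sq' (b * x)
  unfold q0 q1 q2
  generalize sinh (a * x) = S at *
  generalize cosh (a * x) = C at *
  generalize sin (b * x) = s at *
  generalize cos (b * x) = c at *
  ring_nf
  rw [h1, h2]
  ring

lemma q_wr_neg {a b x : ℝ} (ha : 0 < a) (hb : 0 < b) (hx : 0 < x) :
    q0 a b x * q2 a b x - q1 a b x ^ 2 < 0 := by
  rw [q_wr]
  have h1 : a * x < sinh (a * x) := self_lt_sinh_iff.2 (by positivity)
  have h2 : |sin (b * x)| ≤ |b * x| := abs_sin_le_abs
  rw [abs_of_pos (by positivity : 0 < b * x)] at h2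
  have h3 : sin (b * x) ^ 2 ≤ (b * x) ^ 2 := by
    rw [← sq_abs]; gcongr
  have h4 : (a * x) ^ 2 < sinh (a * x) ^ 2 := by gcongr
  have h5 : a ^ 2 * sin (b * x) ^ 2 < b ^ 2 * sinh (a * x) ^ 2 := by
    calc a ^ 2 * sin (b * x) ^ 2 ≤ a ^ 2 * (b * x) ^ 2 := by gcongr
      _ = b ^ 2 * (a * x) ^ 2 := by ring
      _ < _ := by gcongr
  have h6 : 0 < a ^ 2 + b ^ 2 := by positivity
  nlinarith

lemma q_wr3 (a b x : ℝ) : (q0 a b x * q2 a b x - q1 a b x ^ 2) *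
      (q0 a b x * (-((a ^ 2 + b ^ 2) ^ 2 * q0 a b x + 2 * (b ^ 2 - a ^ 2) * q2 a b x))
        - q2 a b x ^ 2) - (q0 a b x * q3 a b x - q1 a b x * q2 a b x) ^ 2 =
    -(4 * a ^ 2 * b ^ 2 * (a ^ 2 + b ^ 2) ^ 2) * q0 a b x ^ 2 := by
  have h1 := cosh_sq (a * x)
  have h2 := cos_sq' (b * x)
  have e1 : q0 a b x * q3 a b x - q1 a b x * q2 a b x = -2 * (a ^ 2 + b ^ 2) * a * b *
      (b * sinh (a * x) * cosh (a * x) - a * sin (b * x) * cos (b * x)) := by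
    unfold q0 q1 q2 q3
    generalize sinh (a * x) = S at *
    generalize cosh (a * x) = C at *
    generalize sin (b * x) = s at *
    generalize cos (b * x) = c at *
    ring_nf
    rw [h1, h2]
    ring
  have e2 : q0 a b x * (-((a ^ 2 + b ^ 2) ^ 2 * q0 a b x + 2 * (b ^ 2 - a ^ 2) * q2 a b x))
        - q2 a b x ^ 2 = -4 * (a ^ 2 + b ^ 2) * a ^ 2 * b ^ 2 *
      (sinh (a * x) ^ 2 + sin (b * x) ^ 2) := by
    unfold q0 q2
    generalize sinh (a * x) = S at *
    generalize cosh (a * x) = C at *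
    generalize sin (b * x) = s at *
    generalize cos (b * x) = c at *
    ring_nf
    rw [h1, h2]
    ring
  rw [e1, e2, q_wr]
  unfold q0
  generalize sinh (a * x) = S at *
  generalize cosh (a * x) = C at *
  generalize sin (b * x) = s at *
  generalize cos (b * x) = c at *
  ring_nf
  rw [h1, h2]
  ring

lemma q0_neg {a b x : ℝ} (ha : 0 < a) (hb : 0 < b) (hx : 0 < x) (hx2 : x ≤ π / b) :
    q0 a b x < 0 := by
  have : StrictAntiOn (q0 a b) (Set.Icc 0 (π / b)) := by
    apply strictAntiOn_of_deriv_neg (convex_Icc _ _)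
    · exact (q0_smooth a b).continuous.continuousOn
    · intro y hy
      rw [interior_Icc] at hy
      rw [((q_chain a b).1 y).deriv]
      have h1 : 0 < sinh (a * y) := sinh_pos_iff.2 (mul_pos ha hy.1)
      have h2 : 0 < sin (b * y) := by
        apply sin_pos_of_pos_of_lt_pi (mul_pos hb hy.1)
        have := hy.2
        rw [lt_div_iff₀ hb] at this; linarith
      have h3 : 0 < (a ^ 2 + b ^ 2) * (sinh (a * y) * sin (b * y)) := by positivity
      unfold q1; linarith
  have h := this ⟨le_rfl, by positivity⟩ ⟨hx.le, hx2⟩ hx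
  simpa [q0] using h

lemma q0_mono {a b : ℝ} (ha : 0 < a) (hb : 0 < b) :
    StrictMonoOn (q0 a b) (Set.Icc (π / b) (3 * π / (2 * b))) := by
  apply strictMonoOn_of_deriv_pos (convex_Icc _ _)
  · exact (q0_smooth a b).continuous.continuousOn
  · intro y hy
    rw [interior_Icc] at hy
    rw [((q_chain a b).1 y).deriv]
    have hy0 : 0 < y := lt_trans (by positivity) hy.1
    have h1 : 0 < sinh (a * y) := sinh_pos_iff.2 (mul_pos ha hy0)
    have h2 : sin (b * y) < 0 := by
      have l1 := hy.1
      have l2 := hy.2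
      rw [div_lt_iff₀ hb] at l1
      rw [lt_div_iff₀ (by positivity)] at l2
      have : 0 < sin (b * y - π) := by
        apply sin_pos_of_pos_of_lt_pi <;> nlinarith [pi_pos]
      rw [sin_sub_pi] at this; linarith
    have h3 : 0 < (a ^ 2 + b ^ 2) * (sinh (a * y) * -sin (b * y)) := by
      have : 0 < -sin (b * y) := by linarith
      positivity
    unfold q1; linarith

lemma q0_iff {a b x : ℝ} (hb : 0 < b) (hx : x ∈ Set.Ioo (π / b) (3 * π / (2 * b))) :
    b * tanh (a * x) = a * tan (b * x) ↔ q0 a b x = 0 := by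
  have l1 := hx.1
  have l2 := hx.2
  rw [div_lt_iff₀ hb] at l1
  rw [lt_div_iff₀ (by positivity)] at l2
  have hc : 0 < cos (b * x - π) := by
    apply cos_pos_of_mem_Ioo; constructor <;> nlinarith [pi_pos]
  rw [cos_sub_pi] at hc
  have hc' : cos (b * x) ≠ 0 := by intro h; simp [h] at hc
  have hC : cosh (a * x) ≠ 0 := (cosh_pos _).ne'
  rw [tanh_eq_sinh_div_cosh, tan_eq_sin_div_cos, mul_div_assoc', mul_div_assoc',
    div_eq_div_iff hC hc']
  unfold q0
  constructor <;> intro h <;> linarith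

lemma exists_l {a b : ℝ} (ha : 0 < a) (hb : 0 < b) :
    ∃ l ∈ Set.Ioo (π / b) (3 * π / (2 * b)), q0 a b l = 0 := by
  have hle : π / b ≤ 3 * π / (2 * b) := by
    rw [div_le_div_iff₀ hb (by positivity)]; nlinarith [pi_pos, mul_pos pi_pos hb]
  have h1 : q0 a b (π / b) < 0 := q0_neg ha hb (by positivity) le_rfl
  have h2 : 0 < q0 a b (3 * π / (2 * b)) := by
    have e : b * (3 * π / (2 * b)) = π / 2 + π := by field_simp; ring
    unfold q0
    rw [e, cos_add_pi, sin_add_pi, cos_pi_div_two, sin_pi_div_two]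
    have := cosh_pos (a * (3 * π / (2 * b)))
    have := mul_pos ha this
    linarith
  obtain ⟨l, hl, hl0⟩ := intermediate_value_Ioo hle
    (q0_smooth a b).continuous.continuousOn ⟨h1, h2⟩
  exact ⟨l, hl, hl0⟩

lemma q0_ne {a b l x : ℝ} (ha : 0 < a) (hb : 0 < b)
    (hl : l ∈ Set.Ioo (π / b) (3 * π / (2 * b))) (hl0 : q0 a b l = 0) (hx : 0 < x) (hxl : x < l) :
    q0 a b x ≠ 0 := by
  apply ne_of_lt
  rcases le_total x (π / b) with h | h
  · exact q0_neg ha hb hx h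
  · rw [← hl0]
    exact q0_mono ha hb ⟨h, (hxl.trans hl.2).le⟩ (Set.Ioo_subset_Icc_self hl) hxl

end

lemma ker_chain {a b : ℝ} {F : ℝ → ℝ}
    (hF : F ∈ kerOp 3 ![(a ^ 2 + b ^ 2) ^ 2, 0, 2 * (b ^ 2 - a ^ 2), 0]) :
    Ch ((a ^ 2 + b ^ 2) ^ 2) (2 * (b ^ 2 - a ^ 2)) F (iteratedDeriv 1 F) (iteratedDeriv 2 F)
      (iteratedDeriv 3 F) := by
  obtain ⟨h1, h2⟩ := hF
  have hd : ∀ n x, HasDerivAt (iteratedDeriv n F) (iteratedDeriv (n + 1) F x) x := by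
    intro n x
    rw [iteratedDeriv_succ]
    refine DifferentiableAt.hasDerivAt ?_
    exact (h1.differentiable_iteratedDeriv n (by exact_mod_cast WithTop.coe_lt_top n)) x
  refine ⟨fun x => ?_, hd 1, hd 2, fun x => (hd 3 x).congr_deriv ?_⟩
  · simpa using hd 0 x
  · have := h2 x
    simp [Fin.sum_univ_four] at this
    simp
    linarith

lemma chain_ker {a b : ℝ} {F F1 F2 F3 : ℝ → ℝ} (sF : Smooth F)
    (hF : Ch ((a ^ 2 + b ^ 2) ^ 2) (2 * (b ^ 2 - a ^ 2)) F F1 F2 F3) :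
    F ∈ kerOp 3 ![(a ^ 2 + b ^ 2) ^ 2, 0, 2 * (b ^ 2 - a ^ 2), 0] := by
  refine ⟨sF, fun x => ?_⟩
  have d1 : deriv F = F1 := funext fun x => (hF.1 x).deriv
  have d2 : deriv F1 = F2 := funext fun x => (hF.2.1 x).deriv
  have d3 : deriv F2 = F3 := funext fun x => (hF.2.2.1 x).deriv
  have d4 := (hF.2.2.2 x).deriv
  simp [Fin.sum_univ_four, iteratedDeriv_succ', d1, d2, d3, d4]

lemma q_iter {a b : ℝ} : iteratedDeriv 1 (q0 a b) = q1 a b ∧ iteratedDeriv 2 (q0 a b) = q2 a b ∧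
    iteratedDeriv 3 (q0 a b) = q3 a b := by
  have hF := q_chain a b
  have d1 : deriv (q0 a b) = q1 a b := funext fun x => (hF.1 x).deriv
  have d2 : deriv (q1 a b) = q2 a b := funext fun x => (hF.2.1 x).deriv
  have d3 : deriv (q2 a b) = q3 a b := funext fun x => (hF.2.2.1 x).deriv
  simp [iteratedDeriv_succ', d1, d2, d3]

lemma ec_of_lt {a b l h : ℝ} (ha : 0 < a) (hb : 0 < b)
    (hl : l ∈ Set.Ioo (Real.pi / b) (3 * Real.pi / (2 * b))) (hl0 : q0 a b l = 0)
    (hhl : h < l) :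
    IsECOn 3 ![(a ^ 2 + b ^ 2) ^ 2, 0, 2 * (b ^ 2 - a ^ 2), 0] (Set.Icc 0 h) := by
  intro F hF hne r xs m hJ hinj _ _ hv
  by_contra hlt
  apply hne
  have hz : HZ 4 h F := HZ_of_zeros xs m hJ hinj hv (by omega)
  set ε := (l - h) / 2 with hε
  have hq := q_chain a b
  have hu : Ch ((a ^ 2 + b ^ 2) ^ 2) (2 * (b ^ 2 - a ^ 2)) (fun x => q0 a b (x + ε))
      (fun x => q1 a b (x + ε)) (fun x => q2 a b (x + ε)) (fun x => q3 a b (x + ε)) :=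
    ⟨fun x => (hq.1 (x + ε)).comp_add_const x ε, fun x => (hq.2.1 (x + ε)).comp_add_const x ε,
      fun x => (hq.2.2.1 (x + ε)).comp_add_const x ε,
      fun x => (hq.2.2.2 (x + ε)).comp_add_const x ε⟩
  have hsm : Smooth (fun x : ℝ => x + ε) := by unfold Smooth; fun_prop
  have hx0 : ∀ x ∈ Set.Icc 0 h, 0 < x + ε := fun x hx => by have := hx.1; linarith
  have w1 : ∀ x ∈ Set.Icc 0 h, q0 a b (x + ε) ≠ 0 := fun x hx =>
    q0_ne ha hb hl hl0 (hx0 x hx) (by have := hx.2; linarith)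
  funext x
  refine no_four_zeros hu (ker_chain hF) ((q0_smooth a b).comp hsm) ((q1_smooth a b).comp hsm)
    ((q2_smooth a b).comp hsm) hF.1 w1 (fun x hx => (q_wr_neg ha hb (hx0 x hx)).ne) ?_ hz x
  intro x hx
  rw [q_wr3]
  have := w1 x hx
  have h2 : a ^ 2 + b ^ 2 ≠ 0 := by positivity
  simp [this, h2, ha.ne', hb.ne']

lemma not_ec {a b l h : ℝ} (ha : 0 < a) (hb : 0 < b) (hlp : 0 < l) (hl0 : q0 a b l = 0)
    (hhl : l ≤ h) :
    ¬ IsECOn 3 ![(a ^ 2 + b ^ 2) ^ 2, 0, 2 * (b ^ 2 - a ^ 2), 0] (Set.Icc 0 h) := by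
  intro hec
  have hne : q0 a b ≠ 0 := by
    intro h0
    have := q0_neg (x := Real.pi / b) ha hb (by positivity) le_rfl
    rw [h0] at this
    simp at this
  have := hec _ (chain_ker (q0_smooth a b) (q_chain a b)) hne 2 ![0, l] ![3, 1]
    (by intro i; fin_cases i
        · simp; linarith
        · simp; exact ⟨hlp.le, hhl⟩)
    (by intro i j hij
        fin_cases i <;> fin_cases j <;> simp_all [hlp.ne', hlp.ne])
    (by intro i; fin_cases i <;> simp) (by intro i; fin_cases i <;> simp)
    (by intro i; fin_cases i
        · intro j hj
          simp at hj
          interval_cases j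
          · simp [q0]
          · rw [q_iter.1]; simp [q1]
          · rw [q_iter.2.1]; simp [q2]
        · intro j hj
          simp at hj
          subst hj
          simpa using hl0)
  simp [Fin.sum_univ_two] at this

/-- for `a, b > 0`, the critical length `ℓ` of
`D⁴ + 2(b² - a²)D² + (a² + b²)²` (kernel spanned by `cosh(ax)cos(bx), sinh(ax)cos(bx),
cosh(ax)sin(bx), sinh(ax)sin(bx)`) lies in `(π/b, 3π/(2b))` and is the unique solution there
of `b tanh(ax) = a tan(bx)`; moreover `ℓ` is the first positive zero of `S₃`, while the
Wronskian `W(S₃, S₃') = S₃ S₃'' - (S₃')²` has no zero in `(0, ∞)`. -/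
theorem stmt12 (a b : ℝ) (ha : 0 < a) (hb : 0 < b) :
    ∃ ℓ : ℝ, critLen 3 ![(a ^ 2 + b ^ 2) ^ 2, 0, 2 * (b ^ 2 - a ^ 2), 0] = (ℓ : EReal) ∧
      ℓ ∈ Set.Ioo (Real.pi / b) (3 * Real.pi / (2 * b)) ∧
      b * Real.tanh (a * ℓ) = a * Real.tan (b * ℓ) ∧
      (∀ x ∈ Set.Ioo (Real.pi / b) (3 * Real.pi / (2 * b)),
        b * Real.tanh (a * x) = a * Real.tan (b * x) → x = ℓ) ∧
      ∀ S ∈ kerOp 3 ![(a ^ 2 + b ^ 2) ^ 2, 0, 2 * (b ^ 2 - a ^ 2), 0],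
        (∀ j < 3, iteratedDeriv j S 0 = 0) → iteratedDeriv 3 S 0 = 1 →
          (S ℓ = 0 ∧ ∀ x : ℝ, 0 < x → x < ℓ → S x ≠ 0) ∧
          ∀ x : ℝ, 0 < x → S x * iteratedDeriv 2 S x - (deriv S x) ^ 2 ≠ 0 := by
  obtain ⟨l, hl, hl0⟩ := exists_l ha hb
  have hlp : 0 < l := lt_trans (by positivity) hl.1
  refine ⟨l, ?_, hl, (q0_iff hb hl).2 hl0, ?_, ?_⟩
  · unfold critLen
    apply le_antisymm
    · apply sSup_le
      rintro _ ⟨h, rfl, -, hec⟩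
      by_contra hlt
      exact not_ec ha hb hlp hl0 (le_of_lt (by simpa using hlt)) hec
    · apply le_of_forall_lt
      intro c hc
      obtain ⟨h, hch, hhl⟩ := EReal.lt_iff_exists_real_btwn.1 hc
      have hhl' : h < l := by exact_mod_cast hhl
      have hmax : max h (l / 2) < l := max_lt hhl' (by linarith)
      refine lt_of_lt_of_le hch (le_trans ?_ (le_sSup ⟨max h (l / 2), rfl,
        lt_of_lt_of_le (by linarith) (le_max_right _ _), ec_of_lt ha hb hl hl0 hmax⟩))
      exact_mod_cast le_max_left _ _
  · intro x hx hxe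
    have := (q0_iff hb hx).1 hxe
    exact (q0_mono ha hb).injOn (Set.Ioo_subset_Icc_self hx) (Set.Ioo_subset_Icc_self hl)
      (this.trans hl0.symm)
  · intro S hS h0 h3
    set σ : ℝ := -(2 * a * b * (a ^ 2 + b ^ 2)) with hσ
    have hσ0 : σ ≠ 0 := by
      rw [hσ]; exact neg_ne_zero.2 (by positivity)
    have hz := ((q_chain a b).smul_sub (c := σ) (ker_chain hS)).uniq 0
      (by have := h0 0 (by omega); simp at this; simp [q0, this])
      (by simp only [h0 1 (by omega)]; simp [q1])
      (by simp only [h0 2 (by omega)]; simp [q2])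
      (by simp only [h3]; simp [q3, hσ]; ring)
    have e0 : q0 a b = fun x => σ * S x := funext fun x => by have := hz x; linarith
    have e1 : ∀ x, q1 a b x = σ * iteratedDeriv 1 S x := fun x =>
      ((q_chain a b).1 x).unique (by rw [e0]; exact ((ker_chain hS).1 x).const_mul σ)
    have e2 : ∀ x, q2 a b x = σ * iteratedDeriv 2 S x := fun x =>
      ((q_chain a b).2.1 x).unique
        (by rw [funext e1]; exact ((ker_chain hS).2.1 x).const_mul σ)
    refine ⟨⟨?_, ?_⟩, ?_⟩
    · rw [e0] at hl0
      exact (mul_eq_zero.1 hl0).resolve_left hσ0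
    · intro x hx hxl hSx
      apply q0_ne ha hb hl hl0 hx hxl
      rw [e0]; simp [hSx]
    · intro x hx hW
      apply (q_wr_neg ha hb hx).ne
      rw [e1, e2, e0]
      rw [← iteratedDeriv_one] at hW
      linear_combination σ ^ 2 * hW
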